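/- Suppose E[G²] < ∞. Then for every q ∈ (1,2] and every δ ∈ (0,1), the limit lim_{σ_w → 0} AMSE(σ_w) exists and is strictly positive. -/

import Mathlib

open MeasureTheory ProbabilityTheory Real Filter Set

noncomputable section

/-- The standard Gaussian measure on `ℝ`. -/
def stdGaussian : Measure ℝ := gaussianReal 0 1

/-- `IsProx q χ u v` : `v` minimizes `z ↦ (1/2)(u−z)² + χ|z|^q`,
i.e. `v = η_q(u;χ)` is the proximal operator of `χ|·|^q` at `u`. -/
def IsProx (q χ u v : ℝ) : Prop :=
  ∀ z : ℝ, (1/2) * (u - v)^2 + χ * |v| ^ q ≤ (1/2) * (u - z)^2 + χ * |z| ^ q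

/-- The law of `B`: the mixture `(1−ε)δ₀ + ε·g`. -/
def mix (ε : ℝ) (g : Measure ℝ) : Measure ℝ :=
  ENNReal.ofReal (1 - ε) • Measure.dirac (0:ℝ) + ENNReal.ofReal ε • g

/-- `min_{χ ≥ 0} E[(η(B+σZ;χ) − B)²]` where `B ~ μB`, `Z ~ N(0,1)` independent. -/
def riskMin (η : ℝ → ℝ → ℝ) (μB : Measure ℝ) (σ : ℝ) : ℝ :=
  ⨅ χ : NNReal, ∫ b, (∫ z, (η (b + σ * z) (χ:ℝ) - b)^2 ∂stdGaussian) ∂μB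

/-- The odd extension `v ↦ sign(v)|v|^(q-1)` of the power function, in the form in which it
appears in the derivative of `|·|^q`. -/
def signedPow (q v : ℝ) : ℝ := |v| ^ (q - 2) * v

lemma signedPow_neg (q v : ℝ) : signedPow q (-v) = -signedPow q v := by
  simp [signedPow]

lemma signedPow_of_nonneg {q v : ℝ} (hq : 1 < q) (hv : 0 ≤ v) : signedPow q v = v ^ (q - 1) := by
  rcases hv.eq_or_lt with rfl | hv
  · simp [signedPow, Real.zero_rpow (sub_ne_zero.2 hq.ne')]
  · rw [signedPow, abs_of_pos hv]
    nth_rewrite 2 [← Real.rpow_one v]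
    rw [← Real.rpow_add hv]
    ring_nf

lemma signedPow_monotone {q : ℝ} (hq : 1 < q) : Monotone (signedPow q) := by
  have key : ∀ x y : ℝ, 0 ≤ x → x ≤ y → signedPow q x ≤ signedPow q y := by
    intro x y hx hxy
    rw [signedPow_of_nonneg hq hx, signedPow_of_nonneg hq (hx.trans hxy)]
    exact Real.rpow_le_rpow hx hxy (by linarith)
  have hnn : ∀ x : ℝ, 0 ≤ x → 0 ≤ signedPow q x := fun x hx => by
    unfold signedPow; positivity
  intro x y hxy
  rcases le_total 0 x with hx | hx
  · exact key x y hx hxy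
  rcases le_total 0 y with hy | hy
  · have h1 := hnn y hy
    have h2 := hnn (-x) (by linarith)
    rw [signedPow_neg] at h2
    linarith
  · have := key (-y) (-x) (by linarith) (by linarith)
    rw [signedPow_neg, signedPow_neg] at this
    linarith

lemma signedPow_mul {q c : ℝ} (hq : 1 < q) (hc : 0 < c) (v : ℝ) :
    signedPow q (c * v) = c ^ (q - 1) * signedPow q v := by
  have h := signedPow_of_nonneg hq hc.le
  rw [← h]
  simp only [signedPow, abs_mul]
  rw [Real.mul_rpow (abs_nonneg _) (abs_nonneg _)]
  ring

/-- First-order condition for the proximal operator. -/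
lemma IsProx.stationary {q χ u v : ℝ} (hq : 1 < q) (h : IsProx q χ u v) :
    v + χ * q * signedPow q v = u := by
  have hd : HasDerivAt (fun z : ℝ => (1/2) * (u - z)^2 + χ * |z| ^ q)
      ((1/2) * (2 * (u - v) * (-1)) + χ * (q * |v| ^ (q - 2) * v)) v := by
    have h1 : HasDerivAt (fun z : ℝ => u - z) (-1) v := by
      simpa using (hasDerivAt_id v).const_sub u
    have h2 := (h1.pow 2).const_mul (1/2)
    have h3 := (hasDerivAt_abs_rpow v hq).const_mul χ
    refine (h2.add h3).congr_deriv ?_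
    norm_num
  have hm : IsLocalMin (fun z : ℝ => (1/2) * (u - z)^2 + χ * |z| ^ q) v :=
    Filter.Eventually.of_forall h
  have := hm.hasDerivAt_eq_zero hd
  unfold signedPow
  linarith

/-- A selection of solutions of the first-order condition `η + χ q sign(η)|η|^(q-1) = u`. -/
def IsProxFamily (q : ℝ) (η : ℝ → ℝ → ℝ) : Prop :=
  ∀ u χ, 0 ≤ χ → η u χ + χ * q * signedPow q (η u χ) = u

lemma stationary_le {q χ u u' v v' : ℝ} (hq : 1 < q) (hχ : 0 ≤ χ)
    (h : v + χ * q * signedPow q v = u) (h' : v' + χ * q * signedPow q v' = u') (hu : u ≤ u') :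
    v ≤ v' := by
  by_contra! hlt
  have := signedPow_monotone hq hlt.le
  have : χ * q * signedPow q v' ≤ χ * q * signedPow q v := by gcongr
  linarith

lemma stationary_unique {q χ u v v' : ℝ} (hq : 1 < q) (hχ : 0 ≤ χ)
    (h : v + χ * q * signedPow q v = u) (h' : v' + χ * q * signedPow q v' = u) : v = v' :=
  le_antisymm (stationary_le hq hχ h h' le_rfl) (stationary_le hq hχ h' h le_rfl)

/-- The residual `u ↦ u - η_q(u;χ)` of the proximal operator. -/
def proxResidual (η : ℝ → ℝ → ℝ) (χ u : ℝ) : ℝ := u - η u χ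

/-- Odd, nondecreasing, `1`-Lipschitz functions that are concave on the positive half-line. -/
structure IsShrinkage (w : ℝ → ℝ) : Prop where
  odd : ∀ u, w (-u) = -w u
  mono : Monotone w
  lip : ∀ x y, x ≤ y → w y - w x ≤ y - x
  concave : ConcaveOn ℝ (Ici 0) w

namespace IsProxFamily

variable {q : ℝ} {η : ℝ → ℝ → ℝ}

lemma residual_eq (h : IsProxFamily q η) {χ : ℝ} (hχ : 0 ≤ χ) (u : ℝ) :
    proxResidual η χ u = χ * q * signedPow q (η u χ) := by
  have := h u χ hχ
  unfold proxResidual; linarith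

lemma monotone (h : IsProxFamily q η) (hq : 1 < q) {χ : ℝ} (hχ : 0 ≤ χ) :
    Monotone (fun u => η u χ) :=
  fun x y hxy => stationary_le hq hχ (h x χ hχ) (h y χ hχ) hxy

lemma neg (h : IsProxFamily q η) (hq : 1 < q) {χ : ℝ} (hχ : 0 ≤ χ) (u : ℝ) :
    η (-u) χ = -η u χ := by
  refine stationary_unique hq hχ (h (-u) χ hχ) ?_
  have := h u χ hχ
  rw [signedPow_neg]; linarith

lemma nonneg (h : IsProxFamily q η) (hq : 1 < q) {χ u : ℝ} (hχ : 0 ≤ χ) (hu : 0 ≤ u) :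
    0 ≤ η u χ := by
  have h1 := h.neg hq hχ u
  have h2 := h.monotone hq hχ (show -u ≤ u by linarith)
  simp only at h2
  linarith

lemma scale (h : IsProxFamily q η) (hq : 1 < q) {χ σ : ℝ} (hχ : 0 ≤ χ) (hσ : 0 < σ) (u : ℝ) :
    η (σ * u) χ = σ * η u (χ * σ ^ (q - 2)) := by
  have hk : 0 ≤ χ * σ ^ (q - 2) := by positivity
  refine stationary_unique hq hχ (h (σ * u) χ hχ) ?_
  have := h u _ hk
  rw [signedPow_mul hq hσ]
  have hp : σ ^ (q - 1) = σ * σ ^ (q - 2) := by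
    nth_rewrite 2 [← Real.rpow_one σ]
    rw [← Real.rpow_add hσ]
    ring_nf
  rw [hp]
  linear_combination σ * this

lemma isShrinkage (h : IsProxFamily q η) (hq : 1 < q) (hq2 : q ≤ 2) {χ : ℝ} (hχ : 0 ≤ χ) :
    IsShrinkage (proxResidual η χ) where
  odd u := by unfold proxResidual; rw [h.neg hq hχ]; ring
  mono x y hxy := by
    rw [h.residual_eq hχ, h.residual_eq hχ]
    have := signedPow_monotone hq (h.monotone hq hχ hxy)
    simp only at this
    gcongr
  lip x y hxy := by
    have := h.monotone hq hχ hxy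
    simp only at this
    unfold proxResidual; linarith
  concave := by
    refine ⟨convex_Ici 0, ?_⟩
    intro x hx y hy a b ha hb hab
    simp only [mem_Ici, smul_eq_mul] at *
    have hex := h.nonneg hq hχ hx
    have hey := h.nonneg hq hχ hy
    rcases le_total (a * η x χ + b * η y χ) (η (a * x + b * y) χ) with hle | hle
    · have hc := (Real.concaveOn_rpow (p := q - 1) (by linarith) (by linarith)).2
        (mem_Ici.2 hex) (mem_Ici.2 hey) ha hb hab
      simp only [smul_eq_mul] at hc
      have hm := signedPow_monotone hq hle
      rw [signedPow_of_nonneg hq (by positivity : 0 ≤ a * η x χ + b * η y χ)] at hm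
      rw [h.residual_eq hχ, h.residual_eq hχ, h.residual_eq hχ, signedPow_of_nonneg hq hex,
        signedPow_of_nonneg hq hey]
      have := mul_le_mul_of_nonneg_left (hc.trans hm) (by positivity : 0 ≤ χ * q)
      linarith
    · unfold proxResidual
      linarith

end IsProxFamily

namespace IsShrinkage

variable {w : ℝ → ℝ}

lemma zero (h : IsShrinkage w) : w 0 = 0 := by
  have := h.odd 0
  rw [neg_zero] at this; linarith

lemma nonneg (h : IsShrinkage w) {u : ℝ} (hu : 0 ≤ u) : 0 ≤ w u := by
  simpa [h.zero] using h.mono hu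

lemma abs_eq (h : IsShrinkage w) (u : ℝ) : |w u| = w |u| := by
  rcases le_total 0 u with hu | hu
  · rw [abs_of_nonneg hu, abs_of_nonneg (h.nonneg hu)]
  · rw [abs_of_nonpos hu, h.odd, abs_of_nonpos]
    have := h.mono hu
    rwa [h.zero] at this

lemma abs_apply_le (h : IsShrinkage w) (u : ℝ) : |w u| ≤ |u| := by
  rw [h.abs_eq]
  have := h.lip 0 |u| (abs_nonneg u)
  rw [h.zero] at this
  linarith

lemma continuous (h : IsShrinkage w) : Continuous w := by
  have : LipschitzWith 1 w := by
    refine LipschitzWith.of_le_add fun x y => ?_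
    rcases le_total x y with hxy | hxy
    · have := h.mono hxy
      have := dist_nonneg (x := x) (y := y)
      linarith
    · have := h.lip y x hxy
      rw [Real.dist_eq, abs_of_nonneg (by linarith)]
      linarith
  exact this.continuous

lemma increment_le (h : IsShrinkage w) {x y d : ℝ} (hx : 0 ≤ x) (hxy : x ≤ y) (hd : 0 ≤ d) :
    w (y + d) - w y ≤ w (x + d) - w x := by
  rcases hd.eq_or_lt with rfl | hd
  · simp
  have hL : 0 < y + d - x := by linarith
  set a := d / (y + d - x) with ha
  have ha0 : 0 ≤ a := by positivity
  have ha1 : 0 ≤ 1 - a := by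
    rw [sub_nonneg, ha, div_le_one hL]; linarith
  have hmul : a * (y + d - x) = d := by rw [ha]; field_simp
  have hX : x ∈ Ici (0:ℝ) := hx
  have hY : y + d ∈ Ici (0:ℝ) := by simp only [mem_Ici]; linarith
  have h1 := h.concave.2 hX hY ha1 ha0 (by ring)
  have h2 := h.concave.2 hX hY ha0 ha1 (by ring)
  simp only [smul_eq_mul] at h1 h2
  rw [show (1 - a) * x + a * (y + d) = x + d by linarith] at h1
  rw [show a * x + (1 - a) * (y + d) = y by linarith] at h2
  linarith

lemma sub_reflect_le (h : IsShrinkage w) {b b' z : ℝ} (hb : 0 ≤ b) (hbb : b ≤ b') (hz : 0 ≤ z) :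
    w (b' + z) - w (b' - z) ≤ w (b + z) - w (b - z) := by
  rcases le_total z b with h1 | h1
  · have := h.increment_le (x := b - z) (y := b + z) (d := b' - b) (by linarith) (by linarith)
      (by linarith)
    ring_nf at this ⊢
    linarith
  rcases le_total b' z with h2 | h2
  · have h3 := h.increment_le (x := z - b') (y := b + z) (d := b' - b) (by linarith) (by linarith)
      (by linarith)
    have h4 := h.odd (z - b')
    have h5 := h.odd (z - b)
    ring_nf at h3 h4 h5 ⊢
    linarith
  · have h3 := h.increment_le (x := 0) (y := b + z) (d := b' - b) (by linarith) (by linarith)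
      (by linarith)
    have h4 := h.increment_le (x := 0) (y := z - b) (d := b' - z) (by linarith) (by linarith)
      (by linarith)
    have h5 := h.odd (z - b)
    have h6 := h.zero
    ring_nf at h3 h4 h5 h6 ⊢
    linarith

end IsShrinkage

section Gaussian

instance : IsProbabilityMeasure _root_.stdGaussian := by unfold _root_.stdGaussian; infer_instance

lemma integrable_sq_stdGaussian : Integrable (fun z : ℝ => z ^ 2) _root_.stdGaussian :=
  (memLp_id_gaussianReal (μ := 0) (v := 1) 2).integrable_sq

lemma integral_sq_stdGaussian : ∫ z, z ^ 2 ∂_root_.stdGaussian = 1 := by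
  have h := variance_fun_id_gaussianReal (μ := 0) (v := 1)
  rw [variance_eq_integral (by fun_prop)] at h
  simpa [_root_.stdGaussian] using h

lemma map_neg_stdGaussian : _root_.stdGaussian.map (fun x => -x) = _root_.stdGaussian := by
  simp [_root_.stdGaussian, gaussianReal_map_neg]

lemma integral_comp_neg_stdGaussian (f : ℝ → ℝ) :
    ∫ z, f (-z) ∂_root_.stdGaussian = ∫ z, f z ∂_root_.stdGaussian := by
  nth_rewrite 2 [← map_neg_stdGaussian]
  exact ((MeasurableEquiv.neg ℝ).measurableEmbedding.integral_map f).symm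

lemma map_add_stdGaussian (b : ℝ) :
    _root_.stdGaussian.map (fun z => b + z) = gaussianReal b 1 := by
  simp [_root_.stdGaussian, gaussianReal_map_const_add]

lemma integral_comp_add_stdGaussian (f : ℝ → ℝ) (b : ℝ) :
    ∫ z, f (b + z) ∂_root_.stdGaussian = ∫ u, gaussianPDFReal b 1 u * f u := by
  have h := (MeasurableEquiv.addLeft b).measurableEmbedding.integral_map (μ := _root_.stdGaussian) f
  have h2 := integral_gaussianReal_eq_integral_smul (μ := b) (f := f) one_ne_zero
  simp only [smul_eq_mul] at h2
  rw [← h2, ← map_add_stdGaussian]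
  exact h.symm

lemma integrable_gaussianPDFReal_mul {f : ℝ → ℝ} {b : ℝ}
    (hf : Integrable (fun z => f (b + z)) _root_.stdGaussian) :
    Integrable (fun u => gaussianPDFReal b 1 u * f u) := by
  have h : Integrable f (gaussianReal b 1) := by
    rw [← map_add_stdGaussian]
    exact ((MeasurableEquiv.addLeft b).measurableEmbedding.integrable_map_iff).2 hf
  rw [gaussianReal_of_var_ne_zero b one_ne_zero,
    integrable_withDensity_iff_integrable_smul' (measurable_gaussianPDF b 1)
      (Filter.Eventually.of_forall fun _ => gaussianPDF_lt_top)] at h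
  simpa [toReal_gaussianPDF] using h

lemma gaussianPDFReal_le_of_abs_le {b b' u : ℝ} (h : |u - b'| ≤ |u - b|) :
    gaussianPDFReal b 1 u ≤ gaussianPDFReal b' 1 u := by
  have := sq_le_sq.2 h
  simp only [gaussianPDFReal]
  gcongr

/-- The Gaussian average of an even function that is nondecreasing in `|·|` is nondecreasing
in the size of the shift. -/
lemma integral_shift_mono {f : ℝ → ℝ} (hf : ∀ x y, |x| ≤ |y| → f x ≤ f y)
    (hint : ∀ b, Integrable (fun z => f (b + z)) _root_.stdGaussian) {b b' : ℝ} (hb : 0 ≤ b)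
    (hbb : b ≤ b') :
    ∫ z, f (b + z) ∂_root_.stdGaussian ≤ ∫ z, f (b' + z) ∂_root_.stdGaussian := by
  set K : ℝ → ℝ := fun u => gaussianPDFReal b' 1 u - gaussianPDFReal b 1 u with hK
  have hKi : Integrable (fun u => K u * f u) := by
    simp only [hK, sub_mul]
    exact (integrable_gaussianPDFReal_mul (hint b')).sub (integrable_gaussianPDFReal_mul (hint b))
  have hdiff : ∫ z, f (b' + z) ∂_root_.stdGaussian - ∫ z, f (b + z) ∂_root_.stdGaussian
      = ∫ u, K u * f u := by
    rw [integral_comp_add_stdGaussian, integral_comp_add_stdGaussian,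
      ← integral_sub (integrable_gaussianPDFReal_mul (hint b'))
        (integrable_gaussianPDFReal_mul (hint b))]
    simp only [hK, sub_mul]
  have hKr : ∀ u, K (b + b' - u) = -K u := by
    intro u
    simp only [hK, gaussianPDFReal]
    rw [show b + b' - u - b' = -(u - b) by ring, show b + b' - u - b = -(u - b') by ring,
      neg_sq, neg_sq]
    ring
  have hrefl : ∫ u, K u * f u = ∫ u, -(K u * f (b + b' - u)) := by
    rw [← integral_sub_left_eq_self (fun u => K u * f u) volume (b + b')]
    simp only [hKr, neg_mul]
  have hrefli : Integrable (fun u => -(K u * f (b + b' - u))) := by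
    have := hKi.comp_sub_left (b + b')
    simpa only [hKr, neg_mul] using this
  have hnn : 0 ≤ ∫ u, (K u * f u + -(K u * f (b + b' - u))) := by
    refine integral_nonneg fun u => ?_
    simp only [Pi.zero_apply]
    rw [show K u * f u + -(K u * f (b + b' - u)) = K u * (f u - f (b + b' - u)) by ring]
    rcases le_total (b + b' - u) u with hu | hu
    · refine mul_nonneg (sub_nonneg.2 (gaussianPDFReal_le_of_abs_le ?_))
        (sub_nonneg.2 (hf _ _ ?_))
      · apply sq_le_sq.1; nlinarith
      · apply sq_le_sq.1; nlinarith
    · refine mul_nonneg_of_nonpos_of_nonpos (sub_nonpos.2 (gaussianPDFReal_le_of_abs_le ?_))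
        (sub_nonpos.2 (hf _ _ ?_))
      · apply sq_le_sq.1; nlinarith
      · apply sq_le_sq.1; nlinarith
  rw [integral_add hKi hrefli, ← hrefl, ← hdiff] at hnn
  linarith

lemma stdGaussian_Icc_pos : 0 < _root_.stdGaussian.real (Icc (-1) 1) := by
  refine ENNReal.toReal_pos ?_ (measure_ne_top _ _)
  intro h
  have := gaussianReal_absolutelyContinuous' 0 one_ne_zero h
  simp at this
  norm_num at this

end Gaussian

/-- The Gaussian mean square error `E[(Z - w(t+Z))²]` at location `t` of an estimator with
residual `w`. -/
def shiftRisk (w : ℝ → ℝ) (t : ℝ) : ℝ := ∫ z, (z - w (t + z)) ^ 2 ∂_root_.stdGaussian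

namespace IsShrinkage

variable {w : ℝ → ℝ}

lemma shiftRisk_neg (h : IsShrinkage w) (t : ℝ) : shiftRisk w (-t) = shiftRisk w t := by
  unfold shiftRisk
  rw [← integral_comp_neg_stdGaussian]
  congr with z
  rw [← neg_add, h.odd]
  ring

lemma integrable_sq_comp (h : IsShrinkage w) (t : ℝ) :
    Integrable (fun z => w (t + z) ^ 2) _root_.stdGaussian := by
  refine Integrable.mono' ((integrable_const (2 * t ^ 2)).add
    (integrable_sq_stdGaussian.const_mul 2)) ?_ (Filter.Eventually.of_forall fun z => ?_)
  · exact (by have := h.continuous; fun_prop : Continuous _).aestronglyMeasurable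
  · rw [Real.norm_of_nonneg (sq_nonneg _)]
    have := sq_le_sq.2 (h.abs_apply_le (t + z))
    simp only [Pi.add_apply]
    nlinarith [sq_nonneg (t - z)]

lemma integrable_mul_comp (h : IsShrinkage w) (t : ℝ) :
    Integrable (fun z => z * w (t + z)) _root_.stdGaussian := by
  refine Integrable.mono' (integrable_sq_stdGaussian.add (h.integrable_sq_comp t)) ?_
    (Filter.Eventually.of_forall fun z => ?_)
  · exact (by have := h.continuous; fun_prop : Continuous _).aestronglyMeasurable
  · simp only [Pi.add_apply]
    rw [Real.norm_eq_abs, abs_le]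
    constructor <;> nlinarith [sq_nonneg (z - w (t + z)), sq_nonneg (z + w (t + z))]

lemma integral_mul_comp_anti (h : IsShrinkage w) {t t' : ℝ} (ht : 0 ≤ t) (htt : t ≤ t') :
    ∫ z, z * w (t' + z) ∂_root_.stdGaussian ≤ ∫ z, z * w (t + z) ∂_root_.stdGaussian := by
  have hneg : ∀ s, ∫ z, z * w (s + z) ∂_root_.stdGaussian = ∫ z, -z * w (s - z) ∂_root_.stdGaussian := by
    intro s
    rw [← integral_comp_neg_stdGaussian]
    rfl
  have hnegi : ∀ s, Integrable (fun z => -z * w (s - z)) _root_.stdGaussian := by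
    intro s
    have := h.integrable_mul_comp s
    rw [← map_neg_stdGaussian] at this
    exact ((MeasurableEquiv.neg ℝ).measurableEmbedding.integrable_map_iff).1 this
  have hsum : ∀ s, 2 * ∫ z, z * w (s + z) ∂_root_.stdGaussian
      = ∫ z, (z * w (s + z) + -z * w (s - z)) ∂_root_.stdGaussian := by
    intro s
    rw [integral_add (h.integrable_mul_comp s) (hnegi s), ← hneg s]
    ring
  have : 2 * ∫ z, z * w (t' + z) ∂_root_.stdGaussian ≤ 2 * ∫ z, z * w (t + z) ∂_root_.stdGaussian := by
    rw [hsum, hsum]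
    refine integral_mono ((h.integrable_mul_comp t').add (hnegi t'))
      ((h.integrable_mul_comp t).add (hnegi t)) fun z => ?_
    simp only
    rcases le_total 0 z with hz | hz
    · have := mul_le_mul_of_nonneg_left (h.sub_reflect_le ht htt hz) hz
      linarith
    · have := mul_le_mul_of_nonneg_left (h.sub_reflect_le ht htt (neg_nonneg.2 hz))
        (neg_nonneg.2 hz)
      rw [← sub_eq_add_neg, ← sub_eq_add_neg, sub_neg_eq_add, sub_neg_eq_add] at this
      linarith
  linarith

lemma shiftRisk_eq (h : IsShrinkage w) (t : ℝ) :
    shiftRisk w t = 1 - 2 * ∫ z, z * w (t + z) ∂_root_.stdGaussian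
      + ∫ z, w (t + z) ^ 2 ∂_root_.stdGaussian := by
  unfold shiftRisk
  rw [← integral_sq_stdGaussian, ← integral_const_mul,
    ← integral_sub integrable_sq_stdGaussian ((h.integrable_mul_comp t).const_mul 2)]
  refine Eq.trans ?_ (integral_add (integrable_sq_stdGaussian.sub
    ((h.integrable_mul_comp t).const_mul 2)) (h.integrable_sq_comp t))
  congr with z
  ring

lemma shiftRisk_mono (h : IsShrinkage w) {t t' : ℝ} (htt : |t| ≤ |t'|) :
    shiftRisk w t ≤ shiftRisk w t' := by
  have habs : ∀ s, shiftRisk w s = shiftRisk w |s| := by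
    intro s
    rcases abs_choice s with hs | hs <;> rw [hs]
    rw [h.shiftRisk_neg]
  rw [habs t, habs t', h.shiftRisk_eq, h.shiftRisk_eq]
  have h1 := h.integral_mul_comp_anti (abs_nonneg t) htt
  have h2 := integral_shift_mono (f := fun u => w u ^ 2) (fun x y hxy => ?_)
    h.integrable_sq_comp (abs_nonneg t) htt
  · linarith
  · rw [sq_le_sq, h.abs_eq, h.abs_eq]
    exact h.mono hxy

lemma integrable_sq_sub_comp (h : IsShrinkage w) (t : ℝ) :
    Integrable (fun z => (z - w (t + z)) ^ 2) _root_.stdGaussian := by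
  refine ((integrable_sq_stdGaussian.sub ((h.integrable_mul_comp t).const_mul 2)).add
    (h.integrable_sq_comp t)).congr (Filter.Eventually.of_forall fun z => ?_)
  simp only [Pi.add_apply, Pi.sub_apply]
  ring

lemma shiftRisk_nonneg (t : ℝ) : 0 ≤ shiftRisk w t :=
  integral_nonneg fun _ => sq_nonneg _

/-- Far from the origin a large residual forces a large risk. -/
lemma le_shiftRisk (h : IsShrinkage w) {A M t : ℝ} (hA : 1 ≤ A) (hw : A ≤ w (M - 1))
    (ht : M ≤ |t|) :
    (A - 1) ^ 2 * _root_.stdGaussian.real (Icc (-1) 1) ≤ shiftRisk w t := by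
  refine le_trans ?_ (mul_meas_ge_le_integral_of_nonneg
    (Filter.Eventually.of_forall fun _ => sq_nonneg _) (h.integrable_sq_sub_comp t) ((A - 1) ^ 2))
  refine mul_le_mul_of_nonneg_left (measureReal_mono fun z hz => ?_) (sq_nonneg _)
  have hz1 : |z| ≤ 1 := abs_le.2 hz
  have h1 : M - 1 ≤ |t + z| := by
    have := abs_sub_abs_le_abs_sub t (-z)
    rw [abs_neg, sub_neg_eq_add] at this
    linarith
  have h2 : A ≤ |w (t + z)| := by
    rw [h.abs_eq]
    exact hw.trans (h.mono h1)
  have h3 := abs_sub_abs_le_abs_sub (w (t + z)) z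
  rw [abs_sub_comm] at h3
  change (A - 1) ^ 2 ≤ (z - w (t + z)) ^ 2
  refine sq_le_sq.2 ?_
  rw [abs_of_nonneg (by linarith)]
  linarith

lemma integrable_shiftRisk (h : IsShrinkage w) {μ : Measure ℝ} [IsFiniteMeasure μ]
    (hμ : Integrable (fun b => b ^ 2) μ) (σ : ℝ) :
    Integrable (fun b => shiftRisk w (b / σ)) μ := by
  have hcont := h.continuous
  have : Integrable (fun p : ℝ × ℝ => (p.2 - w (p.1 / σ + p.2)) ^ 2) (μ.prod _root_.stdGaussian) := by
    refine Integrable.mono' (((hμ.const_mul (2 / σ ^ 2)).comp_fst _root_.stdGaussian).add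
      ((integrable_sq_stdGaussian.const_mul 8).comp_snd μ)) ?_
      (Filter.Eventually.of_forall fun p => ?_)
    · exact (by fun_prop : Continuous _).aestronglyMeasurable
    · rw [Real.norm_of_nonneg (sq_nonneg _)]
      simp only [Pi.add_apply]
      have h1 := sq_le_sq.2 (h.abs_apply_le (p.1 / σ + p.2))
      rw [show 2 / σ ^ 2 * p.1 ^ 2 = 2 * (p.1 / σ) ^ 2 by ring]
      nlinarith [sq_nonneg (p.2 + w (p.1 / σ + p.2)), sq_nonneg (p.1 / σ - 2 * p.2),
        sq_nonneg (w (p.1 / σ + p.2) + 2 * p.2), sq_nonneg (p.1 / σ)]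
  exact this.integral_prod_left

end IsShrinkage

/-- The risk at noise level `σ`, divided by `σ²`, as a function of the rescaled tuning
parameter. -/
def scaledRisk (η : ℝ → ℝ → ℝ) (μ : Measure ℝ) (σ χ : ℝ) : ℝ :=
  ∫ b, shiftRisk (proxResidual η χ) (b / σ) ∂μ

lemma scaledRisk_nonneg (η : ℝ → ℝ → ℝ) (μ : Measure ℝ) (σ χ : ℝ) :
    0 ≤ scaledRisk η μ σ χ :=
  integral_nonneg fun _ => IsShrinkage.shiftRisk_nonneg _

lemma bddBelow_scaledRisk (η : ℝ → ℝ → ℝ) (μ : Measure ℝ) (σ : ℝ) :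
    BddBelow (Set.range fun χ : NNReal => scaledRisk η μ σ χ) :=
  ⟨0, by rintro _ ⟨χ, rfl⟩; exact scaledRisk_nonneg _ _ _ _⟩

namespace IsProxFamily

variable {q : ℝ} {η : ℝ → ℝ → ℝ}

lemma riskMin_eq (h : IsProxFamily q η) (hq : 1 < q) (μ : Measure ℝ) {σ : ℝ} (hσ : 0 < σ) :
    riskMin η μ σ = σ ^ 2 * ⨅ χ : NNReal, scaledRisk η μ σ χ := by
  have hp : 0 < σ ^ (q - 2) := Real.rpow_pos_of_pos hσ _
  obtain ⟨c, hc⟩ : ∃ c : NNReal, (c : ℝ) = σ ^ (q - 2) := ⟨⟨_, hp.le⟩, rfl⟩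
  have hsurj : Function.Surjective (fun χ : NNReal => χ * c) := by
    have hne : c ≠ 0 := by
      rintro rfl
      exact hp.ne hc
    exact fun κ => ⟨κ / c, div_mul_cancel₀ κ hne⟩
  rw [← hsurj.iInf_comp (fun χ : NNReal => scaledRisk η μ σ χ),
    Real.mul_iInf_of_nonneg (sq_nonneg σ)]
  unfold riskMin scaledRisk shiftRisk
  congr with χ
  rw [← integral_const_mul]
  congr with b
  rw [← integral_const_mul]
  congr with z
  have hs := h.scale hq χ.coe_nonneg hσ (b / σ + z)
  rw [show σ * (b / σ + z) = b + σ * z by field_simp] at hs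
  rw [← hc, ← NNReal.coe_mul] at hs
  rw [hs, proxResidual, ← mul_pow]
  congr 1
  field_simp
  ring

lemma scaledRisk_anti (h : IsProxFamily q η) (hq : 1 < q) (hq2 : q ≤ 2) {μ : Measure ℝ}
    [IsFiniteMeasure μ] (hμ : Integrable (fun b => b ^ 2) μ) {χ σ σ' : ℝ} (hχ : 0 ≤ χ)
    (hσ : 0 < σ) (hσσ : σ ≤ σ') : scaledRisk η μ σ' χ ≤ scaledRisk η μ σ χ := by
  have hw := h.isShrinkage hq hq2 hχ
  refine integral_mono (hw.integrable_shiftRisk hμ σ') (hw.integrable_shiftRisk hμ σ) fun b => ?_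
  refine hw.shiftRisk_mono ?_
  rw [abs_div, abs_div, abs_of_pos hσ, abs_of_pos (hσ.trans_le hσσ)]
  gcongr

lemma mul_abs_proxResidual_le (h : IsProxFamily q η) (hq : 1 < q) (hq2 : q ≤ 2) {χ : ℝ}
    (hχ : 0 ≤ χ) (z : ℝ) : |z| * |proxResidual η χ z| ≤ 2 * χ * (1 + z ^ 2) := by
  have hw := h.isShrinkage hq hq2 hχ
  have hz := abs_nonneg z
  have hle : η |z| χ ≤ |z| := by
    have := hw.nonneg hz
    unfold proxResidual at this
    linarith
  have h1 := signedPow_monotone hq hle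
  have h2 : |z| * signedPow q |z| ≤ 1 + z ^ 2 := by
    rw [signedPow_of_nonneg hq hz, ← sq_abs]
    rcases le_total |z| 1 with h1 | h1
    · have := Real.rpow_le_one hz h1 (by linarith : 0 ≤ q - 1)
      nlinarith
    · have := Real.rpow_le_rpow_of_exponent_le h1 (by linarith : q - 1 ≤ 1)
      rw [Real.rpow_one] at this
      nlinarith
  rw [hw.abs_eq, h.residual_eq hχ]
  have h3 := mul_le_mul_of_nonneg_left h1 hz
  calc |z| * (χ * q * signedPow q (η |z| χ)) = χ * q * (|z| * signedPow q (η |z| χ)) := by ring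
    _ ≤ χ * 2 * (1 + z ^ 2) := by
        refine (mul_le_mul_of_nonneg_left (h3.trans h2) (by positivity)).trans ?_
        gcongr
    _ = 2 * χ * (1 + z ^ 2) := by ring

lemma le_shiftRisk_zero (h : IsProxFamily q η) (hq : 1 < q) (hq2 : q ≤ 2) {χ : ℝ}
    (hχ : 0 ≤ χ) : 1 - 8 * χ ≤ shiftRisk (proxResidual η χ) 0 := by
  have hw := h.isShrinkage hq hq2 hχ
  have hi : ∫ z, z * proxResidual η χ (0 + z) ∂_root_.stdGaussian
      ≤ ∫ z, 2 * χ * (1 + z ^ 2) ∂_root_.stdGaussian := by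
    refine integral_mono (hw.integrable_mul_comp 0)
      (((integrable_const 1).add integrable_sq_stdGaussian).const_mul _) fun z => ?_
    simp only [zero_add]
    refine (le_abs_self _).trans ?_
    rw [abs_mul]
    exact h.mul_abs_proxResidual_le hq hq2 hχ z
  rw [integral_const_mul, integral_add (integrable_const 1) integrable_sq_stdGaussian,
    integral_sq_stdGaussian] at hi
  simp only [integral_const, probReal_univ, smul_eq_mul] at hi
  have hn : 0 ≤ ∫ z, proxResidual η χ (0 + z) ^ 2 ∂_root_.stdGaussian :=
    integral_nonneg fun _ => sq_nonneg _
  rw [hw.shiftRisk_eq]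
  linarith

lemma exists_le_proxResidual (h : IsProxFamily q η) (hq : 1 < q) {c : ℝ} (hc : 0 < c) (A : ℝ) :
    ∃ M : ℝ, 1 ≤ M ∧ ∀ χ, c ≤ χ → A ≤ proxResidual η χ (M - 1) := by
  have hlim : Tendsto (fun x : ℝ => c * x ^ (q - 1)) atTop atTop :=
    (tendsto_rpow_atTop (by linarith)).const_mul_atTop hc
  obtain ⟨x, hx1, hx2, hx0⟩ := ((hlim.eventually_ge_atTop A).and
    ((eventually_ge_atTop A).and (eventually_ge_atTop 0))).exists
  refine ⟨2 * x + 1, by linarith, fun χ hχ => ?_⟩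
  have hχ0 : 0 ≤ χ := hc.le.trans hχ
  rw [add_sub_cancel_right]
  rcases le_total x (η (2 * x) χ) with hη | hη
  · rw [h.residual_eq hχ0]
    have h1 := signedPow_monotone hq hη
    rw [signedPow_of_nonneg hq hx0] at h1
    have hcq : c ≤ χ * q := by nlinarith
    calc A ≤ c * x ^ (q - 1) := hx1
      _ ≤ χ * q * signedPow q (η (2 * x) χ) := by gcongr
  · unfold proxResidual
    linarith

/-- At small noise levels the scaled risk exceeds any given number below `1`, uniformly over the
tuning parameter. -/
lemma exists_le_scaledRisk (h : IsProxFamily q η) (hq : 1 < q) (hq2 : q ≤ 2) {μ : Measure ℝ}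
    [IsProbabilityMeasure μ] (hμ : Integrable (fun b => b ^ 2) μ) (hμ0 : μ {0}ᶜ ≠ 0) {δ : ℝ}
    (hδ : δ < 1) :
    ∃ σ₀ : ℝ, 0 < σ₀ ∧ ∀ σ χ, 0 < σ → σ ≤ σ₀ → 0 ≤ χ → δ ≤ scaledRisk η μ σ χ := by
  obtain ⟨n, hn⟩ : ∃ n : ℕ, 0 < μ {b : ℝ | 1 / ((n : ℝ) + 1) ≤ |b|} := by
    refine exists_measure_pos_of_not_measure_iUnion_null fun h0 => hμ0 ?_
    refine measure_mono_null (fun b hb => ?_) h0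
    obtain ⟨n, hn⟩ := exists_nat_one_div_lt (abs_pos.2 hb)
    exact mem_iUnion.2 ⟨n, hn.le⟩
  set a : ℝ := 1 / ((n : ℝ) + 1) with ha
  have ha0 : 0 < a := by positivity
  set p : ℝ := μ.real {b : ℝ | a ≤ |b|} with hp
  have hp0 : 0 < p := ENNReal.toReal_pos hn.ne' (measure_ne_top _ _)
  set r : ℝ := _root_.stdGaussian.real (Icc (-1) 1) with hr
  have hr0 : 0 < r := stdGaussian_Icc_pos
  have hc : 0 < (1 - δ) / 8 := by linarith
  obtain ⟨M, hM, hA⟩ := h.exists_le_proxResidual hq hc (1 + (1 + 1 / (r * p)))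
  have hM0 : 0 < M := by linarith
  refine ⟨a / M, by positivity, fun σ χ hσ hσa hχ => ?_⟩
  have hw := h.isShrinkage hq hq2 hχ
  have hint := hw.integrable_shiftRisk hμ σ
  rcases le_total ((1 - δ) / 8) χ with hcχ | hcχ
  · set D : ℝ := (1 + (1 + 1 / (r * p)) - 1) ^ 2 * r with hD
    have hpos : 0 < 1 / (r * p) := by positivity
    have hDp : 1 ≤ D * p := by
      have : 1 / (r * p) * (r * p) = 1 := by field_simp
      have hrp : 0 < r * p := by positivity
      rw [hD]
      nlinarith [mul_pos hpos hrp, mul_pos hpos (mul_pos hpos hrp)]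
    have hmarkov := mul_meas_ge_le_integral_of_nonneg
      (Filter.Eventually.of_forall fun b => IsShrinkage.shiftRisk_nonneg (b / σ)) hint D
    have hsub : p ≤ μ.real {b | D ≤ shiftRisk (proxResidual η χ) (b / σ)} := by
      refine measureReal_mono fun b hb => ?_
      refine hw.le_shiftRisk (by linarith) (hA χ hcχ) ?_
      rw [abs_div, abs_of_pos hσ, le_div_iff₀ hσ]
      rw [le_div_iff₀ hM0] at hσa
      have : a ≤ |b| := hb
      linarith
    have hD0 : 0 ≤ D := by positivity
    have := mul_le_mul_of_nonneg_left hsub hD0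
    unfold scaledRisk
    linarith
  · have h0 := h.le_shiftRisk_zero hq hq2 hχ
    have : ∫ _, shiftRisk (proxResidual η χ) 0 ∂μ ≤ scaledRisk η μ σ χ :=
      integral_mono (integrable_const _) hint fun b => hw.shiftRisk_mono (by simp)
    simp only [integral_const, probReal_univ, smul_eq_mul, one_mul] at this
    linarith

end IsProxFamily

section Mixture

variable {ε : ℝ} {g : Measure ℝ}

lemma isProbabilityMeasure_mix (hε : ε ∈ Ioo (0:ℝ) 1) [IsProbabilityMeasure g] :
    IsProbabilityMeasure (mix ε g) := by
  refine ⟨?_⟩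
  simp only [mix, Measure.add_apply, Measure.smul_apply, measure_univ, smul_eq_mul, mul_one]
  rw [← ENNReal.ofReal_add (by linarith [hε.2]) hε.1.le]
  simp

lemma integrable_sq_mix (hG2 : Integrable (fun x => x ^ 2) g) :
    Integrable (fun x => x ^ 2) (mix ε g) :=
  ((integrable_dirac (by simp)).smul_measure ENNReal.ofReal_ne_top).add_measure
    (hG2.smul_measure ENNReal.ofReal_ne_top)

lemma mix_compl_zero_ne_zero (hε : 0 < ε) [IsProbabilityMeasure g] (hg0 : g {0} = 0) :
    mix ε g {0}ᶜ ≠ 0 := by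
  have : g {0}ᶜ = 1 := (prob_compl_eq_one_iff (measurableSet_singleton 0)).2 hg0
  simp [mix, this, hε]

end Mixture

/-- For `q ∈ (1,2]` and `δ ∈ (0,1)`, the optimally-tuned AMSE has a strictly positive limit
as `σ_w → 0⁺`. Here `σb σ_w` is the unique positive solution `σ̄` of
`σ̄² = σ_w² + (1/δ)·min_{χ≥0}E[(η_q(B+σ̄Z;χ)−B)²]` and `AMSE(σ_w) = riskMin η (mix ε g) (σb σ_w)`. -/
theorem amse_limit_positive_q
    (q δ ε : ℝ) (hq1 : 1 < q) (hq2 : q ≤ 2) (hδ0 : 0 < δ) (hδ1 : δ < 1)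
    (hε : ε ∈ Ioo (0:ℝ) 1)
    (g : Measure ℝ) [IsProbabilityMeasure g] (hg0 : g {0} = 0)
    (hG2 : Integrable (fun x => x^2) g)
    (η : ℝ → ℝ → ℝ) (hη : ∀ u χ, 0 ≤ χ → IsProx q χ u (η u χ))
    (σb : ℝ → ℝ)
    (hσb : ∀ s, 0 < s → 0 < σb s ∧
      (σb s) ^ 2 = s ^ 2 + (1/δ) * riskMin η (mix ε g) (σb s)) :
    ∃ L : ℝ, 0 < L ∧
      Tendsto (fun s => riskMin η (mix ε g) (σb s)) (nhdsWithin (0:ℝ) (Ioi 0)) (nhds L) := by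
  have hfam : IsProxFamily q η := fun u χ hχ => (hη u χ hχ).stationary hq1
  have := isProbabilityMeasure_mix (g := g) hε
  have hμ := integrable_sq_mix (ε := ε) hG2
  set j : ℝ → ℝ := fun σ => ⨅ χ : NNReal, scaledRisk η (mix ε g) σ χ with hj
  have hR : ∀ σ, 0 < σ → riskMin η (mix ε g) σ = σ ^ 2 * j σ :=
    fun σ hσ => hfam.riskMin_eq hq1 (mix ε g) hσ
  have hanti : ∀ σ σ', 0 < σ → σ ≤ σ' → j σ' ≤ j σ := fun σ σ' hσ hle =>
    ciInf_mono (bddBelow_scaledRisk _ _ _) fun χ => hfam.scaledRisk_anti hq1 hq2 hμ χ.coe_nonneg hσ hle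
  have hfix : ∀ s, 0 < s → δ * s ^ 2 = (σb s) ^ 2 * (δ - j (σb s)) := by
    intro s hs
    obtain ⟨hpos, heq⟩ := hσb s hs
    rw [hR _ hpos] at heq
    field_simp at heq
    linarith
  have hlt : ∀ s, 0 < s → j (σb s) < δ := by
    intro s hs
    by_contra! hle
    have h1 := hfix s hs
    have h2 : 0 < δ * s ^ 2 := by positivity
    nlinarith [sq_nonneg (σb s)]
  obtain ⟨σ₀, hσ₀, hlow⟩ := hfam.exists_le_scaledRisk hq1 hq2 hμ
    (mix_compl_zero_ne_zero hε.1 hg0) hδ1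
  have hge : ∀ s, 0 < s → σ₀ ≤ σb s := by
    intro s hs
    by_contra! hle
    exact (hlt s hs).not_ge (le_ciInf fun χ => hlow _ _ (hσb s hs).1 hle.le χ.coe_nonneg)
  have hmono : MonotoneOn σb (Ioi 0) := by
    intro s hs s' hs' hss
    by_contra! hσ
    have hs0 : 0 < s := hs
    have hs0' : 0 < s' := hs'
    have hpos' := (hσb s' hs0').1
    have h1 := hanti _ _ hpos' hσ.le
    have h2 := hlt s' hs0'
    have h3 : (σb s') ^ 2 * (δ - j (σb s')) < (σb s) ^ 2 * (δ - j (σb s)) :=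
      mul_lt_mul (by gcongr) (by linarith) (by linarith) (sq_nonneg _)
    rw [← hfix s hs0, ← hfix s' hs0'] at h3
    have h4 : δ * s ^ 2 ≤ δ * s' ^ 2 := by gcongr
    linarith
  have hbdd : BddBelow (σb '' Ioi 0) := ⟨σ₀, by rintro _ ⟨s, hs, rfl⟩; exact hge s hs⟩
  have hlim := hmono.tendsto_nhdsGT hbdd
  have hinf : σ₀ ≤ sInf (σb '' Ioi 0) :=
    le_csInf ((nonempty_Ioi).image _) (by rintro _ ⟨s, hs, rfl⟩; exact hge s hs)
  have hinf0 : 0 < sInf (σb '' Ioi 0) := hσ₀.trans_le hinf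
  refine ⟨δ * (sInf (σb '' Ioi 0) ^ 2 - 0 ^ 2), by rw [zero_pow two_ne_zero, sub_zero]; positivity,
    ?_⟩
  have hs : Tendsto (fun s : ℝ => s) (nhdsWithin 0 (Ioi 0)) (nhds 0) :=
    tendsto_id.mono_left nhdsWithin_le_nhds
  refine (((hlim.pow 2).sub (hs.pow 2)).const_mul δ).congr' ?_
  filter_upwards [self_mem_nhdsWithin] with s hs
  have := (hσb s hs).2
  field_simp at this
  linarith
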